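/- arXiv:1807.02969 — 3 statements merged into one kernel-verified Lean document; each statement's English description precedes it below -/
import Mathlib

section
/- Let X be a complete, σ-compact metric space, ν a finite Borel measure on X, and T a real-valued function of pairs (f,π) (f : X → ℝ bounded Borel, π : X → ℝ Lipschitz) satisfying: (i) f ↦ T(f,π) is linear for each fixed π; (ii) |T(f,π)| ≤ Lip(π)·∫_X |f| dν for all pairs (f,π); (iii) (locality) T(f·χ_E, π) = T(f·χ_E, π') whenever E ⊆ X is Borel and the Lipschitz functions π, π' agree on the closure of E. Then for every Lipschitz function u : X → ℝ one has |T(1,u)| ≤ ∫_X Lip(u,x) dν(x). -/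
open MeasureTheory Metric Set Filter ENNReal

/-- The pointwise (upper) Lipschitz constant of `u` regarded as a function on `A ⊆ X`,
at the point `y`:  `Lip(u,y) = limsup_{ρ→0⁺} sup { |u(y)-u(z)|/ρ : z ∈ A, d(z,y) ≤ ρ }`. -/
noncomputable def pLip {X : Type*} [MetricSpace X] (u : X → ℝ) (A : Set X) (y : X) : ℝ≥0∞ :=
  Filter.limsup
    (fun ρ : ℝ => ⨆ z ∈ {z | z ∈ A ∧ dist z y ≤ ρ}, ENNReal.ofReal (|u y - u z| / ρ))
    (nhdsWithin 0 (Set.Ioi 0))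

/-- A function `f : X → ℝ` is bounded Borel. -/
def BoundedBorel {X : Type*} [MeasurableSpace X] (f : X → ℝ) : Prop :=
  Measurable f ∧ ∃ M : ℝ, ∀ x, |f x| ≤ M

/-- The points at which `u` is `t`-Lipschitz at every scale below `δ`. -/
def lipScaleSet {X : Type*} [MetricSpace X] (u : X → ℝ) (t δ : ℝ) : Set X :=
  {x | ∀ z, dist z x < δ → |u x - u z| ≤ t * dist z x}

theorem isClosed_lipScaleSet {X : Type*} [MetricSpace X] {u : X → ℝ} (hu : Continuous u)
    (t δ : ℝ) : IsClosed (lipScaleSet u t δ) := by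
  have h : lipScaleSet u t δ =
      ⋂ z, ({x | dist z x < δ}ᶜ ∪ {x | |u x - u z| ≤ t * dist z x}) := by
    ext x
    simp only [lipScaleSet, mem_ofPred_eq, mem_iInter, mem_union, mem_compl_iff, imp_iff_not_or]
  rw [h]
  refine isClosed_iInter fun z => IsClosed.union ?_ ?_
  · exact (isOpen_lt (by fun_prop) continuous_const).isClosed_compl
  · exact isClosed_le (by fun_prop) (by fun_prop)

theorem pLip_le_of_mem_lipScaleSet {X : Type*} [MetricSpace X] {u : X → ℝ} {t δ : ℝ}
    (ht : 0 ≤ t) (hδ : 0 < δ) {x : X} (hx : x ∈ lipScaleSet u t δ) :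
    pLip u univ x ≤ ENNReal.ofReal t := by
  refine limsup_le_of_le ?_ ?_
  · isBoundedDefault
  filter_upwards [Ioo_mem_nhdsGT hδ] with ρ hρ
  refine iSup₂_le fun z hz => ENNReal.ofReal_le_ofReal ?_
  rw [div_le_iff₀ hρ.1]
  exact (hx z (hz.2.trans_lt hρ.2)).trans (mul_le_mul_of_nonneg_left hz.2 ht)

theorem exists_mem_lipScaleSet_of_pLip_lt {X : Type*} [MetricSpace X] {u : X → ℝ} {t : ℝ}
    (ht : 0 ≤ t) {x : X} (hx : pLip u univ x < ENNReal.ofReal t) :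
    ∃ n : ℕ, x ∈ lipScaleSet u t (1 / (n + 1)) := by
  have h := eventually_lt_of_limsup_lt hx
  obtain ⟨δ, hδ, h⟩ := (mem_nhdsGT_iff_exists_Ioo_subset).1 h
  obtain ⟨n, hn⟩ := exists_nat_one_div_lt (show (0 : ℝ) < δ from hδ)
  refine ⟨n, fun z hz => ?_⟩
  rcases eq_or_ne z x with rfl | hzx
  · simp
  have hpos : 0 < dist z x := dist_pos.2 hzx
  have h1 := h ⟨hpos, hz.trans hn⟩
  have h2 : ENNReal.ofReal (|u x - u z| / dist z x) ≤ ENNReal.ofReal t :=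
    le_trans (le_iSup₂ (f := fun z' (_ : z' ∈ {z' | z' ∈ univ ∧ dist z' x ≤ dist z x}) =>
      ENNReal.ofReal (|u x - u z'| / dist z x)) z ⟨mem_univ z, le_rfl⟩) (le_of_lt h1)
  exact (div_le_iff₀ hpos).1 ((ENNReal.ofReal_le_ofReal_iff ht).1 h2)

theorem pLip_le_of_lipschitzWith {X : Type*} [MetricSpace X] {u : X → ℝ} {K : NNReal}
    (hu : LipschitzWith K u) (x : X) : pLip u univ x ≤ K := by
  have h := pLip_le_of_mem_lipScaleSet (u := u) (x := x) K.2 one_pos fun z _ => by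
    rw [dist_comm, ← Real.dist_eq]
    exact hu.dist_le_mul x z
  exact h.trans_eq ENNReal.ofReal_coe_nnreal

theorem exists_nnrat_between {a b : ℝ≥0∞} (h : a < b) :
    ∃ q : ℚ≥0, a < ENNReal.ofReal q ∧ ENNReal.ofReal q < b := by
  obtain ⟨q, hq, h1, h2⟩ := ENNReal.lt_iff_exists_rat_btwn.1 h
  exact ⟨⟨q, hq⟩, h1, h2⟩

theorem measurable_pLip {X : Type*} [MetricSpace X] [MeasurableSpace X] [BorelSpace X]
    {u : X → ℝ} (hu : Continuous u) : Measurable (pLip u univ) := by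
  refine measurable_of_Iio fun a => ?_
  have h : pLip u univ ⁻¹' Iio a =
      ⋃ (q : ℚ≥0) (_ : ENNReal.ofReal q < a) (n : ℕ), lipScaleSet u q (1 / (n + 1)) := by
    ext x
    simp only [mem_preimage, mem_Iio, mem_iUnion, exists_prop]
    constructor
    · intro hx
      obtain ⟨q, h1, h2⟩ := exists_nnrat_between hx
      exact ⟨q, h2, exists_mem_lipScaleSet_of_pLip_lt (by positivity) h1⟩
    · rintro ⟨q, h2, n, hn⟩
      exact (pLip_le_of_mem_lipScaleSet (by positivity) (by positivity) hn).trans_lt h2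
  rw [h]
  exact .iUnion fun q => .iUnion fun _ => .iUnion fun n =>
    (isClosed_lipScaleSet hu _ _).measurableSet

/-- A finitely additive set function dominated by a finite measure, and locally dominated by
`∫⁻ h` on the pieces of a countable cover, is globally dominated by `∫⁻ h`. -/
theorem ofReal_abs_le_lintegral_of_countable_cover {X ι : Type*} [MeasurableSpace X]
    [Countable ι] (ν : Measure X) [IsFiniteMeasure ν] (τ : Set X → ℝ)
    (hadd : ∀ E F, MeasurableSet E → MeasurableSet F → Disjoint E F → τ (E ∪ F) = τ E + τ F)
    (L : NNReal) (hbound : ∀ E, MeasurableSet E → ENNReal.ofReal |τ E| ≤ L * ν E)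
    (h : X → ℝ≥0∞) (S : ι → Set X) (hS : ∀ i, MeasurableSet (S i)) (hcover : ⋃ i, S i = univ)
    (hlocal : ∀ i E, MeasurableSet E → E ⊆ S i → ENNReal.ofReal |τ E| ≤ ∫⁻ x in E, h x ∂ν) :
    ENNReal.ofReal |τ univ| ≤ ∫⁻ x, h x ∂ν := by
  have hunion : ∀ {E F : Set X} {a b : ℝ≥0∞}, MeasurableSet E → MeasurableSet F → Disjoint E F →
      ENNReal.ofReal |τ E| ≤ a → ENNReal.ofReal |τ F| ≤ b →
      ENNReal.ofReal |τ (E ∪ F)| ≤ a + b := by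
    intro E F a b hE hF hEF ha hb
    rw [hadd E F hE hF hEF]
    refine (ENNReal.ofReal_le_ofReal (abs_add_le _ _)).trans ?_
    rw [ENNReal.ofReal_add (abs_nonneg _) (abs_nonneg _)]
    exact add_le_add ha hb
  rcases isEmpty_or_nonempty ι with hι | hι
  · have h0 : (univ : Set X) = ∅ := by rw [← hcover, iUnion_of_empty]
    refine (hbound univ .univ).trans ?_
    simp [h0]
  obtain ⟨e, he⟩ := exists_surjective_nat ι
  let F : ℕ → Set X := fun n => ⋃ i < n, S (e i)
  have hF : ∀ n, MeasurableSet (F n) := fun n => .iUnion fun i => .iUnion fun _ => hS _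
  have hFsucc : ∀ n, F (n + 1) = F n ∪ (S (e n) \ F n) := by
    intro n
    rw [union_sdiff_self]
    exact biUnion_lt_succ (fun i => S (e i)) n
  have hFle : ∀ n, ENNReal.ofReal |τ (F n)| ≤ ∫⁻ x in F n, h x ∂ν := by
    intro n
    induction n with
    | zero =>
      refine (hbound _ (hF 0)).trans ?_
      simp [F]
    | succ n ih =>
      have hm : MeasurableSet (S (e n) \ F n) := (hS _).diff (hF n)
      rw [hFsucc, lintegral_union hm disjoint_sdiff_right]
      exact hunion (hF n) hm disjoint_sdiff_right ih (hlocal (e n) _ hm sdiff_subset)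
  have hFmono : Monotone F := monotone_nat_of_le_succ fun n => by
    rw [hFsucc]
    exact subset_union_left
  have hFcover : ⋂ n, (F n)ᶜ = ∅ := by
    rw [← compl_iUnion, compl_empty_iff, ← univ_subset_iff, ← hcover]
    refine iUnion_subset fun i => ?_
    obtain ⟨n, rfl⟩ := he i
    exact (subset_biUnion_of_mem (u := fun i => S (e i)) (show n ∈ Iio (n + 1) by simp)).trans
      (subset_iUnion F (n + 1))
  have htail : Tendsto (fun n => ∫⁻ x, h x ∂ν + L * ν (F n)ᶜ) atTop (nhds (∫⁻ x, h x ∂ν)) := by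
    have h1 := tendsto_measure_iInter_atTop (μ := ν) (fun n => (hF n).compl.nullMeasurableSet)
      (fun m n hmn => compl_subset_compl.2 (hFmono hmn)) ⟨0, measure_ne_top _ _⟩
    rw [hFcover, measure_empty] at h1
    have h2 := ENNReal.Tendsto.const_mul h1 (Or.inr (ENNReal.coe_ne_top (r := L)))
    simpa using tendsto_const_nhds.add h2
  refine ge_of_tendsto' htail fun n => ?_
  rw [← union_compl_self (F n)]
  refine hunion (hF n) (hF n).compl disjoint_compl_right ?_ (hbound _ (hF n).compl)
  exact (hFle n).trans (setLIntegral_le_lintegral _ _)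

theorem lipschitzOnWith_of_subset_lipScaleSet {X : Type*} [MetricSpace X] {u : X → ℝ}
    {K : NNReal} {δ : ℝ} {c : X} {E : Set X} (hE : E ⊆ lipScaleSet u K δ)
    (hball : E ⊆ ball c (δ / 2)) : LipschitzOnWith K u E := by
  refine LipschitzOnWith.of_dist_le_mul fun x hx y hy => ?_
  have hyx : dist y x < δ := by
    have h1 := mem_ball.1 (hball hx)
    have h2 := mem_ball.1 (hball hy)
    linarith [dist_triangle_right y x c]
  rw [Real.dist_eq, dist_comm x y]
  exact hE hx y hyx

theorem boundedBorel_one_mul_indicator {X : Type*} [MeasurableSpace X] {E : Set X}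
    (hE : MeasurableSet E) : BoundedBorel fun x => (1 : ℝ) * E.indicator 1 x := by
  refine ⟨measurable_const.mul (measurable_one.indicator hE), 1, fun x => ?_⟩
  by_cases hx : x ∈ E <;> simp [hx]

theorem integral_abs_one_mul_indicator {X : Type*} [MeasurableSpace X] (ν : Measure X)
    {E : Set X} (hE : MeasurableSet E) :
    ∫ x, |(1 : ℝ) * E.indicator 1 x| ∂ν = ν.real E := by
  rw [← integral_indicator_one hE]
  congr 1
  ext x
  by_cases hx : x ∈ E <;> simp [hx]

/-- if `T` is a functional of pairs `(f,π)` (`f` bounded Borel, `π` Lipschitz)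
which is linear in `f`, dominated by `Lip(π)·∫|f| dν`, and local (`T(fχ_E,π)` depends only on
the values of `π` on the closure of `E`), then `|T(1,u)| ≤ ∫ Lip(u,x) dν(x)` for every
Lipschitz `u`. -/
theorem statement0
    {X : Type*} [MetricSpace X] [CompleteSpace X] [SigmaCompactSpace X]
    [MeasurableSpace X] [BorelSpace X]
    (ν : Measure X) [IsFiniteMeasure ν]
    (T : (X → ℝ) → (X → ℝ) → ℝ)
    (hlin : ∀ π : X → ℝ, (∃ K, LipschitzWith K π) →
      ∀ f g : X → ℝ, BoundedBorel f → BoundedBorel g → ∀ a b : ℝ,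
        T (fun x => a * f x + b * g x) π = a * T f π + b * T g π)
    (hmass : ∀ f : X → ℝ, BoundedBorel f → ∀ π : X → ℝ, ∀ K : NNReal, LipschitzWith K π →
      |T f π| ≤ (K : ℝ) * ∫ x, |f x| ∂ν)
    (hloc : ∀ E : Set X, MeasurableSet E → ∀ π π' : X → ℝ,
      (∃ K, LipschitzWith K π) → (∃ K, LipschitzWith K π') →
      Set.EqOn π π' (closure E) →
      ∀ f : X → ℝ, BoundedBorel f →
        T (fun x => f x * E.indicator 1 x) π = T (fun x => f x * E.indicator 1 x) π')
    (u : X → ℝ) (hu : ∃ K, LipschitzWith K u) :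
    ENNReal.ofReal |T (fun _ => 1) u| ≤ ∫⁻ x, pLip u Set.univ x ∂ν := by
  obtain ⟨L, hL⟩ := hu
  have hmassInd : ∀ E, MeasurableSet E → ∀ π (K : NNReal), LipschitzWith K π →
      ENNReal.ofReal |T (fun x => 1 * E.indicator 1 x) π| ≤ K * ν E := by
    intro E hE π K hπ
    have h := hmass _ (boundedBorel_one_mul_indicator hE) π K hπ
    rw [integral_abs_one_mul_indicator ν hE] at h
    refine (ENNReal.ofReal_le_ofReal h).trans_eq ?_
    rw [ENNReal.ofReal_mul K.coe_nonneg, ofReal_measureReal, ENNReal.ofReal_coe_nnreal]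
  have hadd : ∀ E F : Set X, MeasurableSet E → MeasurableSet F → Disjoint E F →
      T (fun x => 1 * (E ∪ F).indicator 1 x) u =
        T (fun x => 1 * E.indicator 1 x) u + T (fun x => 1 * F.indicator 1 x) u := by
    intro E F hE hF hEF
    have h := hlin u ⟨L, hL⟩ _ _ (boundedBorel_one_mul_indicator hE)
      (boundedBorel_one_mul_indicator hF) 1 1
    rw [one_mul, one_mul] at h
    rw [← h, indicator_union_of_disjoint hEF]
    congr 1
    ext x
    ring
  have hmeas := measurable_pLip hL.continuous
  have := EMetric.secondCountable_of_sigmaCompact X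
  obtain ⟨s, hs, hsd⟩ := TopologicalSpace.exists_countable_dense X
  have : Countable s := hs.to_subtype
  have key : ∀ ε : NNReal, 0 < ε →
      ENNReal.ofReal |T (fun _ => 1) u| ≤ ∫⁻ x, (pLip u univ x + ε) ∂ν := by
    intro ε hε
    let S : ℚ≥0 × ℕ × s → Set X := fun i =>
      lipScaleSet u ((i.1 : NNReal) : ℝ) (1 / (i.2.1 + 1)) ∩
        ({x | ((i.1 : NNReal) : ℝ≥0∞) ≤ pLip u univ x + ε} ∩
          ball (i.2.2 : X) (1 / (i.2.1 + 1) / 2))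
    have h := ofReal_abs_le_lintegral_of_countable_cover ν
      (fun E => T (fun x => 1 * E.indicator 1 x) u) hadd L (fun E hE => hmassInd E hE u L hL)
      (fun x => pLip u univ x + ε) S ?_ ?_ ?_
    · simpa using h
    · intro i
      exact (isClosed_lipScaleSet hL.continuous _ _).measurableSet.inter
        ((measurableSet_le measurable_const (hmeas.add_const _)).inter measurableSet_ball)
    · refine eq_univ_of_forall fun x => mem_iUnion.2 ?_
      have hlt : pLip u univ x < pLip u univ x + ε :=
        ENNReal.lt_add_right
          ((pLip_le_of_lipschitzWith hL x).trans_lt ENNReal.coe_lt_top).ne (by simpa using hε.ne')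
      obtain ⟨q, h1, h2⟩ := exists_nnrat_between hlt
      obtain ⟨n, hn⟩ := exists_mem_lipScaleSet_of_pLip_lt (by positivity) h1
      obtain ⟨c, hcs, hc⟩ := hsd.exists_dist_lt x (show (0 : ℝ) < 1 / (n + 1) / 2 by positivity)
      have hqr : ((q : NNReal) : ℝ) = q := rfl
      refine ⟨(q, n, ⟨c, hcs⟩), ?_, ?_, hc⟩
      · exact hqr.symm ▸ hn
      · rw [← hqr, ENNReal.ofReal_coe_nnreal] at h2
        exact h2.le
    · rintro ⟨q, n, c⟩ E hE hES
      have hlip : LipschitzOnWith (q : NNReal) u E :=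
        lipschitzOnWith_of_subset_lipScaleSet (fun x hx => (hES hx).1) (fun x hx => (hES hx).2.2)
      obtain ⟨v, hv, huv⟩ := hlip.extend_real
      have huv' : EqOn u v (closure E) := huv.closure hL.continuous hv.continuous
      have hT := hloc E hE u v ⟨L, hL⟩ ⟨_, hv⟩ huv' (fun _ => 1) ⟨measurable_const, 1, by simp⟩
      simp only [hT]
      refine (hmassInd E hE v _ hv).trans ?_
      rw [← setLIntegral_const]
      exact setLIntegral_mono' hE fun x hx => (hES hx).2.1
  have hlim : Tendsto (fun n : ℕ => ∫⁻ x, pLip u univ x ∂ν +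
      ((1 / ((n : NNReal) + 1) : NNReal) : ℝ≥0∞) * ν univ) atTop
      (nhds (∫⁻ x, pLip u univ x ∂ν)) := by
    have h1 : Tendsto (fun n : ℕ => ((1 / ((n : NNReal) + 1) : NNReal) : ℝ≥0∞)) atTop (nhds 0) :=
      ENNReal.tendsto_coe.2 tendsto_one_div_add_atTop_nhds_zero_nat
    have h2 := ENNReal.Tendsto.mul_const h1 (Or.inr (measure_ne_top ν univ))
    simpa using tendsto_const_nhds.add h2
  refine ge_of_tendsto' hlim fun n => ?_
  refine (key (1 / ((n : NNReal) + 1)) (by positivity)).trans_eq ?_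
  rw [lintegral_add_right _ measurable_const, lintegral_const]
end

section
/- Let X be a complete, σ-compact metric space, ν a finite Borel measure on X, u : X → ℝ a Lipschitz function, and let ε ∈ (0,1) and δ > 0. Then there exist countably many pairwise disjoint compact sets E_1, E_2, … and Z_1, Z_2, …, constants L_i ∈ (0,∞), and a Borel set N ⊆ X with ν(N) < ε, such that X = (∪_i E_i) ∪ (∪_i Z_i) ∪ N, the restriction u|_{E_i} is L_i-Lipschitz with Lip(u,x) ≥ (1−ε)·L_i for every x ∈ E_i, and the restriction u|_{Z_i} is δ-Lipschitz for every i. -/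
open MeasureTheory Metric Set Filter ENNReal

/-- The points at which `u` has all difference quotients on scale below `r` bounded by `a`. -/
def slopeLE {X : Type*} [MetricSpace X] (u : X → ℝ) (a r : ℝ) : Set X :=
  {x | ∀ z, dist x z < r → |u x - u z| ≤ a * dist x z}

/-- The points near which the difference quotients of `u` are eventually bounded by `a`. -/
def eventuallySlopeLE {X : Type*} [MetricSpace X] (u : X → ℝ) (a : ℝ) : Set X :=
  ⋃ n : ℕ, slopeLE u a (1 / (n + 1))

lemma isClosed_slopeLE {X : Type*} [MetricSpace X] {u : X → ℝ} (hu : Continuous u) (a r : ℝ) :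
    IsClosed (slopeLE u a r) := by
  have h : slopeLE u a r = ⋂ z, ({x | r ≤ dist x z} ∪ {x | |u x - u z| ≤ a * dist x z}) := by
    ext x
    simp only [slopeLE, mem_ofPred_eq, mem_iInter, mem_union, ← not_lt (b := r), imp_iff_not_or]
  rw [h]
  refine isClosed_iInter fun z => IsClosed.union ?_ ?_
  · exact isClosed_le continuous_const (by fun_prop)
  · exact isClosed_le (by fun_prop) (by fun_prop)

lemma measurableSet_eventuallySlopeLE {X : Type*} [MetricSpace X] [MeasurableSpace X]
    [BorelSpace X] {u : X → ℝ} (hu : Continuous u) (a : ℝ) :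
    MeasurableSet (eventuallySlopeLE u a) :=
  MeasurableSet.iUnion fun _ => (isClosed_slopeLE hu _ _).measurableSet

lemma lipschitzOnWith_slopeLE_inter_ball {X : Type*} [MetricSpace X] (u : X → ℝ) {a : ℝ}
    (ha : 0 ≤ a) (r : ℝ) (q : X) :
    LipschitzOnWith (Real.toNNReal a) u (slopeLE u a r ∩ ball q (r / 2)) := by
  refine LipschitzOnWith.of_dist_le_mul fun x hx y hy => ?_
  rw [Real.coe_toNNReal a ha, Real.dist_eq]
  refine hx.1 y ?_
  have h1 := mem_ball.1 hx.2
  have h2 := mem_ball.1 hy.2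
  linarith [dist_triangle_right x y q]

lemma le_pLip_of_notMem_eventuallySlopeLE {X : Type*} [MetricSpace X] {u : X → ℝ} {a : ℝ} {x : X}
    (hx : x ∉ eventuallySlopeLE u a) : ENNReal.ofReal a ≤ pLip u univ x := by
  refine le_limsup_of_frequently_le ?_
  rw [(nhdsGT_basis (0 : ℝ)).frequently_iff]
  intro r hr
  obtain ⟨n, hn⟩ := exists_nat_one_div_lt hr
  simp only [eventuallySlopeLE, slopeLE, mem_iUnion, mem_ofPred_eq, not_exists, not_forall,
    not_le] at hx
  obtain ⟨z, hz, hlt⟩ := hx n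
  have hpos : 0 < dist x z := by
    refine dist_pos.2 fun h => ?_
    simp [h] at hlt
  refine ⟨dist x z, ⟨hpos, hz.trans hn⟩, ?_⟩
  refine le_iSup₂_of_le z ⟨mem_univ z, (dist_comm z x).le⟩ ?_
  exact ENNReal.ofReal_le_ofReal ((le_div_iff₀ hpos).2 hlt.le)

/-- A countable measurable cover can be replaced, up to small measure, by pairwise disjoint compact
subsets of its members. -/
lemma exists_isCompact_disjoint_of_measurable_cover {X : Type*} [MetricSpace X]
    [SigmaCompactSpace X] [MeasurableSpace X] [BorelSpace X] (ν : Measure X) [IsFiniteMeasure ν]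
    {C : ℕ → Set X} (hC : ∀ i, MeasurableSet (C i)) (hcov : ⋃ i, C i = univ)
    {ε : ℝ≥0∞} (hε : ε ≠ 0) :
    ∃ D : ℕ → Set X, (∀ i, IsCompact (D i)) ∧ (∀ i, D i ⊆ C i) ∧
      (Pairwise fun i j => Disjoint (D i) (D j)) ∧ ν (⋃ i, D i)ᶜ < ε := by
  obtain ⟨η, hη, hsum⟩ := ENNReal.exists_pos_sum_of_countable' hε ℕ
  have hm : ∀ i, MeasurableSet (disjointed C i) := fun i => MeasurableSet.disjointed hC i
  choose D hDs hDc hD using fun i =>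
    (hm i).exists_isCompact_sdiff_lt (μ := ν) (measure_ne_top ν _) (hη i).ne'
  refine ⟨D, hDc, fun i => (hDs i).trans (disjointed_subset C i),
    fun i j hij => (disjoint_disjointed C hij).mono (hDs i) (hDs j), ?_⟩
  have hsub : (⋃ i, D i)ᶜ ⊆ ⋃ i, disjointed C i \ D i := by
    intro x hx
    have hxC : x ∈ ⋃ i, disjointed C i := by rw [iUnion_disjointed, hcov]; trivial
    obtain ⟨i, hi⟩ := mem_iUnion.1 hxC
    exact mem_iUnion.2 ⟨i, hi, fun h => hx (mem_iUnion.2 ⟨i, h⟩)⟩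
  calc ν (⋃ i, D i)ᶜ ≤ ∑' i, ν (disjointed C i \ D i) :=
        (measure_mono hsub).trans (measure_iUnion_le _)
    _ ≤ ∑' i, η i := ENNReal.tsum_le_tsum fun i => (hD i).le
    _ < ε := hsum

/-- The whole space is a countable union of measurable sets on each of which `u` is either
`δ`-Lipschitz, or `L`-Lipschitz with pointwise Lipschitz constant at least `(1 - ε) * L`. -/
lemma exists_measurable_cover_lipschitzOnWith {X : Type*} [MetricSpace X] [SigmaCompactSpace X]
    [MeasurableSpace X] [BorelSpace X] {u : X → ℝ} {K : NNReal} (hu : LipschitzWith K u)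
    {ε δ : ℝ} (hε : ε ∈ Ioo (0 : ℝ) 1) (hδ : 0 < δ) :
    ∃ C : ℕ → Set X, (∀ i, MeasurableSet (C i)) ∧ ⋃ i, C i = univ ∧
      ∀ i, LipschitzOnWith (Real.toNNReal δ) u (C i) ∨
        ∃ L : ℝ, 0 < L ∧ LipschitzOnWith (Real.toNNReal L) u (C i) ∧
          ∀ x ∈ C i, ENNReal.ofReal ((1 - ε) * L) ≤ pLip u univ x := by
  rcases isEmpty_or_nonempty X with hX | hX
  · exact ⟨fun _ => ∅, fun _ => .empty, Subsingleton.elim _ _, fun _ => Or.inl (by simp)⟩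
  have hε' : 0 < 1 - ε := sub_pos.2 hε.2
  let a : ℕ → ℝ := fun k => δ * ((1 - ε)⁻¹) ^ k
  have ha : ∀ k, 0 < a k := fun k => by positivity
  have ha_succ : ∀ k, (1 - ε) * a (k + 1) = a k := fun k => by
    simp only [a, pow_succ]
    field_simp
  let G : ℕ → Set X := fun k => Nat.casesOn k univ fun j => (eventuallySlopeLE u (a j))ᶜ
  have hG : ∀ k, MeasurableSet (G k) := fun k => by
    cases k with
    | zero => exact .univ
    | succ j => exact (measurableSet_eventuallySlopeLE hu.continuous _).compl
  let r : ℕ → ℝ := fun n => 1 / (n + 1)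
  let B : ℕ × ℕ × ℕ → Set X := fun p =>
    slopeLE u (a p.1) (r p.2.1) ∩ ball (TopologicalSpace.denseSeq X p.2.2) (r p.2.1 / 2) ∩ G p.1
  obtain ⟨e, he⟩ := exists_surjective_nat (ℕ × ℕ × ℕ)
  refine ⟨fun i => B (e i), fun i => ?_, ?_, fun i => ?_⟩
  · exact ((isClosed_slopeLE hu.continuous _ _).measurableSet.inter measurableSet_ball).inter (hG _)
  · refine eq_univ_of_forall fun x => ?_
    have hex : ∃ k, x ∈ eventuallySlopeLE u (a k) := by
      obtain ⟨k, hk⟩ := pow_unbounded_of_one_lt ((K : ℝ) / δ)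
        ((one_lt_inv₀ hε').2 (by linarith [hε.1]))
      refine ⟨k, mem_iUnion.2 ⟨0, fun z _ => ?_⟩⟩
      have hK : (K : ℝ) ≤ a k := by
        rw [div_lt_iff₀ hδ] at hk
        simp only [a]
        linarith
      rw [← Real.dist_eq]
      exact (hu.dist_le_mul x z).trans (by gcongr)
    classical
    have hxG : x ∈ G (Nat.find hex) := by
      cases h : Nat.find hex with
      | zero => trivial
      | succ j => exact Nat.find_min hex (by omega)
    obtain ⟨n, hn⟩ := mem_iUnion.1 (Nat.find_spec hex)
    have hr : 0 < r n / 2 := by positivity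
    obtain ⟨m, hm⟩ := (TopologicalSpace.denseRange_denseSeq X).exists_dist_lt x hr
    obtain ⟨i, hi⟩ := he (Nat.find hex, n, m)
    refine mem_iUnion.2 ⟨i, ?_⟩
    simp only [hi]
    exact ⟨⟨hn, hm⟩, hxG⟩
  · dsimp only
    obtain ⟨k, n, m⟩ := e i
    have hlip : LipschitzOnWith (Real.toNNReal (a k)) u (B (k, n, m)) :=
      (lipschitzOnWith_slopeLE_inter_ball u (ha k).le _ _).mono inter_subset_left
    cases k with
    | zero =>
      left
      simpa [a] using hlip
    | succ j =>
      refine Or.inr ⟨a (j + 1), ha _, hlip, fun x hx => ?_⟩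
      rw [ha_succ]
      exact le_pLip_of_notMem_eventuallySlopeLE hx.2

/-- decomposition of a complete σ-compact metric measure space into countably
many pairwise disjoint compact pieces `E_i` (on which `u` is `L_i`-Lipschitz and the pointwise
Lipschitz constant is at least `(1-ε)L_i`) and `Z_i` (on which `u` is `δ`-Lipschitz), up to a
Borel set `N` of `ν`-measure less than `ε`. -/
theorem statement1
    {X : Type*} [MetricSpace X] [CompleteSpace X] [SigmaCompactSpace X]
    [MeasurableSpace X] [BorelSpace X]
    (ν : Measure X) [IsFiniteMeasure ν]
    (u : X → ℝ) (hu : ∃ K, LipschitzWith K u)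
    (ε δ : ℝ) (hε : ε ∈ Set.Ioo (0 : ℝ) 1) (hδ : 0 < δ) :
    ∃ (E Z : ℕ → Set X) (L : ℕ → ℝ) (N : Set X),
      (∀ i, IsCompact (E i)) ∧ (∀ i, IsCompact (Z i)) ∧
      (Pairwise fun i j : ℕ ⊕ ℕ => Disjoint (Sum.elim E Z i) (Sum.elim E Z j)) ∧
      MeasurableSet N ∧ ν N < ENNReal.ofReal ε ∧
      (Set.univ : Set X) = (⋃ i, E i) ∪ (⋃ i, Z i) ∪ N ∧
      (∀ i, 0 < L i) ∧
      (∀ i, LipschitzOnWith (Real.toNNReal (L i)) u (E i)) ∧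
      (∀ i, ∀ x ∈ E i, ENNReal.ofReal ((1 - ε) * L i) ≤ pLip u Set.univ x) ∧
      (∀ i, LipschitzOnWith (Real.toNNReal δ) u (Z i)) := by
  obtain ⟨K, hK⟩ := hu
  obtain ⟨C, hCm, hCu, hC⟩ := exists_measurable_cover_lipschitzOnWith hK hε hδ
  obtain ⟨D, hDc, hDC, hDd, hDν⟩ := exists_isCompact_disjoint_of_measurable_cover ν hCm hCu
    (ε := ENNReal.ofReal ε) (by simpa using hε.1)
  classical
  let P : ℕ → Prop := fun i => LipschitzOnWith (Real.toNNReal δ) u (C i)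
  have hL : ∀ i, ∃ L : ℝ, 0 < L ∧ (¬ P i → LipschitzOnWith (Real.toNNReal L) u (C i) ∧
      ∀ x ∈ C i, ENNReal.ofReal ((1 - ε) * L) ≤ pLip u univ x) := fun i => by
    by_cases h : P i
    · exact ⟨1, one_pos, fun h' => absurd h h'⟩
    · obtain ⟨L, hL, hL'⟩ := (hC i).resolve_left h
      exact ⟨L, hL, fun _ => hL'⟩
  choose L hLpos hL using hL
  refine ⟨fun i => if P i then ∅ else D i, fun i => if P i then D i else ∅, L, (⋃ i, D i)ᶜ,
    fun i => ?_, fun i => ?_, ?_, ?_, hDν, ?_, hLpos, fun i => ?_, fun i x hx => ?_, fun i => ?_⟩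
  · dsimp only
    split_ifs
    exacts [isCompact_empty, hDc i]
  · dsimp only
    split_ifs
    exacts [hDc i, isCompact_empty]
  · rintro (i | i) (j | j) hij <;> simp only [Sum.elim_inl, Sum.elim_inr] <;> split_ifs with hi hj <;>
      first
      | exact disjoint_bot_left
      | exact disjoint_bot_right
      | exact hDd fun h => by subst h; first | exact hij rfl | contradiction
  · exact (MeasurableSet.iUnion fun i => (hDc i).measurableSet).compl
  · refine (eq_univ_of_forall fun x => ?_).symm
    by_cases hx : x ∈ ⋃ i, D i
    · obtain ⟨i, hi⟩ := mem_iUnion.1 hx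
      by_cases h : P i
      · exact Or.inl (Or.inr (mem_iUnion.2 ⟨i, by simpa [h] using hi⟩))
      · exact Or.inl (Or.inl (mem_iUnion.2 ⟨i, by simpa [h] using hi⟩))
    · exact Or.inr hx
  · dsimp only
    split_ifs with h
    · exact lipschitzOnWith_empty _ _
    · exact (hL i h).1.mono (hDC i)
  · by_cases h : P i
    · simp [h] at hx
    · exact (hL i h).2 x (hDC i (by simpa [h] using hx))
  · dsimp only
    split_ifs with h
    · exact h.mono (hDC i)
    · exact lipschitzOnWith_empty _ _
end

section
/- Let (X,d) be a complete metric space carrying a doubling Borel measure μ, let s ≠ t be points of X, C₀ ≥ 1, and write B₀ := B(s, C₀·d(s,t)). Suppose T is a real-valued function of pairs (f,π) (f : X → ℝ bounded Borel, π : X → ℝ Lipschitz) satisfying properties (i)–(iii) below with respect to the finite Borel measure ν := w·μ, where w : X → [0,∞) is Borel, w vanishes μ-a.e. outside B₀, and w(y) ≤ C₀·[1/Θ(s,d(s,y)) + 1/Θ(t,d(t,y))] for μ-a.e. y ∈ X. If moreover T(1,u) = u(t) − u(s) for every Lipschitz u : X → ℝ, then every Lipschitz u : X → ℝ satisfies |u(t)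 − u(s)| ≤ C₀·∫_{B₀} Lip(u,y)·[1/Θ(s,d(s,y)) + 1/Θ(t,d(t,y))] dμ(y). -/
open MeasureTheory Metric Set Filter ENNReal

/-- `1/Θ(x,d(x,y)) = d(x,y)/μ(B(x,d(x,y)))`, the reciprocal of the 1-dimensional density,
as an extended nonnegative real (equal to `0` at `y = x`). -/
noncomputable def invTheta {X : Type*} [MetricSpace X] [MeasurableSpace X]
    (μ : Measure X) (x y : X) : ℝ≥0∞ :=
  ENNReal.ofReal (dist x y) / μ (ball x (dist x y))

theorem secondCountableTopology_of_measure_ball {X : Type*} [MetricSpace X] [MeasurableSpace X]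
    [BorelSpace X] [Nonempty X] (μ : Measure X)
    (hball : ∀ (x : X) (ρ : ℝ), 0 < ρ → 0 < μ (ball x ρ) ∧ μ (ball x ρ) < ⊤) :
    SecondCountableTopology X := by
  obtain ⟨o⟩ := ‹Nonempty X›
  have : SigmaFinite μ := by
    refine ⟨⟨⟨fun n : ℕ => ball o (n + 1), fun _ => trivial,
      fun n => (hball o _ (by positivity)).2, ?_⟩⟩⟩
    refine eq_univ_of_forall fun x => mem_iUnion.2 ?_
    obtain ⟨n, hn⟩ := exists_nat_gt (dist x o)
    exact ⟨n, by rw [mem_ball]; linarith⟩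
  refine Metric.secondCountable_of_almost_dense_set fun ε hε => ?_
  obtain ⟨N, -, hdisj, hcov⟩ := Vitali.exists_disjoint_subfamily_covering_enlargement_closedBall
    (univ : Set X) id (fun _ => ε / 4) (ε / 4) (fun _ _ => le_rfl) 4 (by norm_num)
  refine ⟨N, ?_, fun x => ?_⟩
  · have key := Measure.countable_meas_pos_of_disjoint_iUnion (μ := μ)
      (As := fun x : N => closedBall (x : X) (ε / 4)) (fun _ => isClosed_closedBall.measurableSet)
      (fun a b hab => hdisj a.2 b.2 (Subtype.coe_injective.ne hab))
    have huniv : {x : N | 0 < μ (closedBall (x : X) (ε / 4))} = univ :=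
      eq_univ_of_forall fun x =>
        (hball x (ε / 4) (by positivity)).1.trans_le (measure_mono ball_subset_closedBall)
    rw [huniv, countable_univ_iff] at key
    exact key
  · obtain ⟨y, hy, hsub⟩ := hcov x (mem_univ x)
    refine ⟨y, hy, ?_⟩
    have := hsub (mem_closedBall_self (by positivity))
    simp only [id, mem_closedBall] at this
    linarith

/-- The points around which `u` has Lipschitz constant `a` at all scales below `r`. -/
def lipSublevel {X : Type*} [MetricSpace X] (u : X → ℝ) (a r : ℝ) : Set X :=
  {y | ∀ z, dist y z < r → |u y - u z| ≤ a * dist y z}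

theorem isClosed_lipSublevel {X : Type*} [MetricSpace X] {u : X → ℝ} (hu : Continuous u)
    (a r : ℝ) : IsClosed (lipSublevel u a r) := by
  have h : lipSublevel u a r =
      ⋂ z, ({y | dist y z < r}ᶜ ∪ {y | |u y - u z| ≤ a * dist y z}) := by
    ext y
    simp only [lipSublevel, mem_ofPred_eq, mem_iInter, mem_union, mem_compl_iff, imp_iff_not_or]
  rw [h]
  refine isClosed_iInter fun z => IsClosed.union ?_ ?_
  · exact (isOpen_lt (by fun_prop) (by fun_prop)).isClosed_compl
  · exact isClosed_le (by fun_prop) (by fun_prop)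

theorem exists_mem_lipSublevel_of_pLip_lt {X : Type*} [MetricSpace X] {u : X → ℝ} {y : X} {a : ℝ}
    (h : pLip u univ y < ENNReal.ofReal a) : ∃ k : ℕ, y ∈ lipSublevel u a (1 / (k + 1)) := by
  have ha : 0 < a := ENNReal.ofReal_pos.1 (bot_le.trans_lt h)
  have hev := eventually_lt_of_limsup_lt h
  obtain ⟨δ, hδ, hsub⟩ := mem_nhdsGT_iff_exists_Ioo_subset.1 hev
  obtain ⟨k, hk⟩ := exists_nat_one_div_lt (show (0 : ℝ) < δ from hδ)
  refine ⟨k, fun z hz => ?_⟩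
  rcases (dist_nonneg (x := y) (y := z)).eq_or_lt with h0 | h0
  · obtain rfl := dist_eq_zero.1 h0.symm
    simp
  · have hlt := hsub ⟨h0, hz.trans hk⟩
    simp only [mem_ofPred_eq] at hlt
    have hle : ENNReal.ofReal (|u y - u z| / dist y z) ≤ ENNReal.ofReal a :=
      (le_iSup₂_of_le (f := fun z' (_ : z' ∈ {z' | z' ∈ univ ∧ dist z' y ≤ dist y z}) =>
        ENNReal.ofReal (|u y - u z'| / dist y z)) z
        ⟨mem_univ _, (dist_comm z y).le⟩ le_rfl).trans hlt.le
    rw [ENNReal.ofReal_le_ofReal_iff ha.le, div_le_iff₀ h0] at hle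
    exact hle

/-- A Lipschitz function on a separable space is, on the pieces of a countable Borel partition,
Lipschitz with a constant exceeding its pointwise Lipschitz constant by at most `ε`. -/
theorem exists_partition_lipschitzOnWith {X : Type*} [MetricSpace X] [MeasurableSpace X]
    [BorelSpace X] [Nonempty X] [SecondCountableTopology X] {u : X → ℝ} {K : NNReal}
    (hu : LipschitzWith K u) {ε : NNReal} (hε : 0 < ε) :
    ∃ (E : ℕ → Set X) (a : ℕ → NNReal), (∀ i, MeasurableSet (E i)) ∧
      Pairwise (Function.onFun Disjoint E) ∧ ⋃ i, E i = univ ∧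
      (∀ i, LipschitzOnWith (a i) u (E i)) ∧
      ∀ i, ∀ y ∈ E i, (a i : ℝ≥0∞) ≤ pLip u univ y + ε := by
  let c : ℕ → NNReal := fun j => ε * (j + 1)
  let F : ℕ → ℕ → Set X := fun j k => lipSublevel u (c j) (1 / (k + 1))
  let L : ℕ → Set X := fun j => ⋃ k, F j k
  have hFm : ∀ j k, MeasurableSet (F j k) := fun j k =>
    (isClosed_lipSublevel hu.continuous _ _).measurableSet
  have hLm : ∀ j, MeasurableSet (L j) := fun j => MeasurableSet.iUnion (hFm j)
  let G : ℕ × ℕ × ℕ → Set X := fun p =>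
    (L p.1 \ ⋃ i ∈ Iio p.1, L i) ∩
      (F p.1 p.2.1 ∩ ball (TopologicalSpace.denseSeq X p.2.2) (1 / (p.2.1 + 1) / 2))
  have hGm : ∀ p, MeasurableSet (G p) := fun p =>
    ((hLm _).diff (MeasurableSet.biUnion (to_countable _) fun i _ => hLm i)).inter
      ((hFm _ _).inter isOpen_ball.measurableSet)
  have hLcov : ∀ y, ∃ j, y ∈ L j := by
    intro y
    obtain ⟨j, hj⟩ := exists_nat_ge (K / ε)
    refine ⟨j, mem_iUnion.2 ⟨0, fun z _ => ?_⟩⟩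
    have hKc : K ≤ c j := by
      rw [div_le_iff₀ hε] at hj
      refine hj.trans ?_
      simp only [c]
      rw [mul_comm]
      gcongr
      simp
    have h := hu.dist_le_mul y z
    rw [Real.dist_eq] at h
    refine h.trans ?_
    gcongr
  have hGcov : ⋃ p, G p = univ := by
    classical
    refine eq_univ_of_forall fun y => ?_
    have hmin : ∀ i < Nat.find (hLcov y), y ∉ L i := fun i hi => Nat.find_min (hLcov y) hi
    have hj := Nat.find_spec (hLcov y)
    obtain ⟨k, hk⟩ := mem_iUnion.1 hj
    obtain ⟨m, hm⟩ := (TopologicalSpace.denseRange_denseSeq X).exists_dist_lt y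
      (show 0 < 1 / ((k : ℝ) + 1) / 2 by positivity)
    refine mem_iUnion.2 ⟨(Nat.find (hLcov y), k, m), ⟨hj, ?_⟩, hk, hm⟩
    simpa only [mem_iUnion, mem_Iio, not_exists] using hmin
  have hGlip : ∀ p, LipschitzOnWith (c p.1) u (G p) := by
    intro p
    refine LipschitzOnWith.of_dist_le_mul fun y hy z hz => ?_
    rw [Real.dist_eq]
    refine hy.2.1 z ?_
    have h1 := mem_ball.1 hy.2.2
    have h2 := mem_ball'.1 hz.2.2
    linarith [dist_triangle y (TopologicalSpace.denseSeq X p.2.2) z]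
  have hGle : ∀ p, ∀ y ∈ G p, (c p.1 : ℝ≥0∞) ≤ pLip u univ y + ε := by
    rintro ⟨_ | j, k, m⟩ y hy
    · simp [c]
    · have hnot : y ∉ L j := fun h => hy.1.2 (mem_biUnion (Nat.lt_succ_self j) h)
      have hle : (c j : ℝ≥0∞) ≤ pLip u univ y := by
        by_contra! hlt
        rw [← ENNReal.ofReal_coe_nnreal] at hlt
        exact hnot (mem_iUnion.2 (exists_mem_lipSublevel_of_pLip_lt hlt))
      have hc : c (j + 1) = c j + ε := by simp only [c]; push_cast; ring
      simp only [hc, ENNReal.coe_add]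
      gcongr
  let e : ℕ ≃ ℕ × ℕ × ℕ := (Denumerable.eqv (ℕ × ℕ × ℕ)).symm
  have hsub : ∀ i, disjointed (G ∘ e) i ⊆ G (e i) := fun i => disjointed_subset _ i
  refine ⟨disjointed (G ∘ e), fun i => c (e i).1, fun i => MeasurableSet.disjointed
    (fun i => hGm _) i, disjoint_disjointed _, ?_, fun i => (hGlip _).mono (hsub i),
    fun i y hy => hGle _ y (hsub i hy)⟩
  rw [iUnion_disjointed, ← hGcov]
  exact e.surjective.iUnion_comp G

/-- A finitely additive set function dominated by a finite measure satisfies the countable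
triangle inequality. -/
theorem ofReal_abs_iUnion_le_tsum {X : Type*} [MeasurableSpace X] (ν : Measure X)
    [IsFiniteMeasure ν] (Φ : Set X → ℝ) (K : NNReal)
    (hadd : ∀ A B, MeasurableSet A → MeasurableSet B → Disjoint A B → Φ (A ∪ B) = Φ A + Φ B)
    (hdom : ∀ A, MeasurableSet A → ENNReal.ofReal |Φ A| ≤ K * ν A)
    {E : ℕ → Set X} (hE : ∀ i, MeasurableSet (E i)) (hd : Pairwise (Function.onFun Disjoint E)) :
    ENNReal.ofReal |Φ (⋃ i, E i)| ≤ ∑' i, ENNReal.ofReal |Φ (E i)| := by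
  have hR : ∀ n, MeasurableSet (⋃ i ≥ n, E i) := fun n =>
    MeasurableSet.biUnion (to_countable _) fun i _ => hE i
  have hstep : ∀ n, ENNReal.ofReal |Φ (⋃ i, E i)| ≤
      ∑ i ∈ Finset.range n, ENNReal.ofReal |Φ (E i)| + ENNReal.ofReal |Φ (⋃ i ≥ n, E i)| := by
    intro n
    induction n with
    | zero => simp
    | succ n ih =>
      refine ih.trans ?_
      rw [Finset.sum_range_succ, add_assoc]
      gcongr
      have hsplit : ⋃ i ≥ n, E i = E n ∪ ⋃ i ≥ n + 1, E i := by
        ext x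
        simp only [mem_iUnion, mem_union, exists_prop]
        constructor
        · rintro ⟨i, hi, hx⟩
          rcases eq_or_lt_of_le hi with rfl | hlt
          · exact Or.inl hx
          · exact Or.inr ⟨i, hlt, hx⟩
        · rintro (hx | ⟨i, hi, hx⟩)
          · exact ⟨n, le_rfl, hx⟩
          · exact ⟨i, (Nat.le_succ n).trans hi, hx⟩
      have hdis : Disjoint (E n) (⋃ i ≥ n + 1, E i) := by
        simp only [disjoint_iUnion_right]
        exact fun i hi => hd (Nat.ne_of_lt hi)
      rw [hsplit, hadd _ _ (hE n) (hR _) hdis, ← ENNReal.ofReal_add (abs_nonneg _) (abs_nonneg _)]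
      exact ENNReal.ofReal_le_ofReal (abs_add_le _ _)
  have htail : Tendsto (fun n => K * ν (⋃ i ≥ n, E i)) atTop (nhds 0) := by
    have h := ENNReal.Tendsto.const_mul
      (tendsto_measure_biUnion_Ici_zero_of_pairwise_disjoint (μ := ν)
        (fun i => (hE i).nullMeasurableSet) hd) (Or.inr (ENNReal.coe_ne_top (r := K)))
    simpa using h
  have hlim := htail.const_add (∑' i, ENNReal.ofReal |Φ (E i)|)
  rw [add_zero] at hlim
  refine ge_of_tendsto' hlim fun n => (hstep n).trans ?_
  gcongr
  · exact ENNReal.sum_le_tsum _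
  · exact hdom _ (hR n)

theorem boundedBorel_indicator_one {X : Type*} [MeasurableSpace X] {A : Set X}
    (hA : MeasurableSet A) : BoundedBorel (A.indicator (1 : X → ℝ)) := by
  refine ⟨measurable_one.indicator hA, 1, fun x => ?_⟩
  by_cases hx : x ∈ A <;> simp [hx]

/-- if `T` is a functional of pairs (linear in `f`, dominated by
`Lip(π)·∫|f| dν` with `ν = w·μ`, and local), where the Borel density `w` vanishes a.e. outside
`B₀ = B(s, C₀·d(s,t))` and satisfies `w ≤ C₀·[1/Θ(s,d(s,·)) + 1/Θ(t,d(t,·))]` a.e., and if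
`T(1,u) = u(t) - u(s)` for all Lipschitz `u`, then
`|u(t) - u(s)| ≤ C₀·∫_{B₀} Lip(u,y)·[1/Θ(s,d(s,y)) + 1/Θ(t,d(t,y))] dμ(y)`. -/
theorem statement2
    {X : Type*} [MetricSpace X] [CompleteSpace X] [MeasurableSpace X] [BorelSpace X]
    (μ : Measure X) (Cμ : ℝ) (hCμ : 1 ≤ Cμ)
    (hball : ∀ (x : X) (ρ : ℝ), 0 < ρ → 0 < μ (ball x ρ) ∧ μ (ball x ρ) < ⊤)
    (hdoub : ∀ (x : X) (ρ : ℝ), 0 < ρ → μ (ball x (2 * ρ)) ≤ ENNReal.ofReal Cμ * μ (ball x ρ))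
    (s t : X) (hst : s ≠ t) (C₀ : ℝ) (hC₀ : 1 ≤ C₀)
    (w : X → ℝ≥0∞) (hwmeas : Measurable w)
    (hw0 : ∀ᵐ y ∂μ, y ∉ ball s (C₀ * dist s t) → w y = 0)
    (hwb : ∀ᵐ y ∂μ, w y ≤ ENNReal.ofReal C₀ * (invTheta μ s y + invTheta μ t y))
    (T : (X → ℝ) → (X → ℝ) → ℝ)
    (hlin : ∀ π : X → ℝ, (∃ K, LipschitzWith K π) →
      ∀ f g : X → ℝ, BoundedBorel f → BoundedBorel g → ∀ a b : ℝ,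
        T (fun x => a * f x + b * g x) π = a * T f π + b * T g π)
    (hmass : ∀ f : X → ℝ, BoundedBorel f → ∀ π : X → ℝ, ∀ K : NNReal, LipschitzWith K π →
      |T f π| ≤ (K : ℝ) * ∫ x, |f x| ∂(μ.withDensity w))
    (hloc : ∀ E : Set X, MeasurableSet E → ∀ π π' : X → ℝ,
      (∃ K, LipschitzWith K π) → (∃ K, LipschitzWith K π') →
      Set.EqOn π π' (closure E) →
      ∀ f : X → ℝ, BoundedBorel f →
        T (fun x => f x * E.indicator 1 x) π = T (fun x => f x * E.indicator 1 x) π')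
    (hbdry : ∀ v : X → ℝ, (∃ K, LipschitzWith K v) → T (fun _ => 1) v = v t - v s)
    (u : X → ℝ) (hu : ∃ K, LipschitzWith K u) :
    ENNReal.ofReal |u t - u s| ≤
      ENNReal.ofReal C₀ *
        ∫⁻ y in ball s (C₀ * dist s t),
          pLip u Set.univ y * (invTheta μ s y + invTheta μ t y) ∂μ := by
  have hBone : BoundedBorel (fun _ : X => (1 : ℝ)) := ⟨measurable_const, 1, by simp⟩
  have : Nonempty X := ⟨s⟩
  have := secondCountableTopology_of_measure_ball μ hball
  set ν := μ.withDensity w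
  have hfin : IsFiniteMeasure ν := by
    refine ⟨lt_top_iff_ne_top.2 fun htop => hst ?_⟩
    have hLip : LipschitzWith 1 (fun x => dist x s) := LipschitzWith.dist_left s
    have h := hmass _ hBone _ 1 hLip
    rw [hbdry _ ⟨1, hLip⟩] at h
    have h0 : ∫ x, |(fun _ : X => (1 : ℝ)) x| ∂ν = 0 := by simp [Measure.real, htop]
    rw [h0, mul_zero, dist_self, sub_zero, abs_of_nonneg dist_nonneg] at h
    exact (dist_le_zero.1 h).symm
  obtain ⟨K, hK⟩ := hu
  have hind : ∀ A, MeasurableSet A → ∀ π : X → ℝ, ∀ L : NNReal, LipschitzWith L π →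
      ENNReal.ofReal |T (A.indicator 1) π| ≤ L * ν A := by
    intro A hA π L hπ
    have h := hmass _ (boundedBorel_indicator_one hA) π L hπ
    have hint : ∫ x, |A.indicator (1 : X → ℝ) x| ∂ν = ν.real A := by
      rw [← integral_indicator_one hA]
      congr 1 with x
      by_cases hx : x ∈ A <;> simp [hx]
    rw [hint] at h
    refine (ENNReal.ofReal_le_ofReal h).trans_eq ?_
    rw [ENNReal.ofReal_mul L.coe_nonneg, ENNReal.ofReal_coe_nnreal, ofReal_measureReal]
  have hadd : ∀ A B, MeasurableSet A → MeasurableSet B → Disjoint A B →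
      T ((A ∪ B).indicator 1) u = T (A.indicator 1) u + T (B.indicator 1) u := by
    intro A B hA hB hAB
    have h := hlin u ⟨K, hK⟩ _ _ (boundedBorel_indicator_one hA) (boundedBorel_indicator_one hB) 1 1
    simp only [one_mul] at h
    rw [← h, indicator_union_of_disjoint hAB]
  have hbound : ∀ ε : NNReal, 0 < ε →
      ENNReal.ofReal |u t - u s| ≤ ∫⁻ y, pLip u univ y ∂ν + ε * ν univ := by
    intro ε hε
    obtain ⟨E, a, hE, hd, hcov, hlip, hle⟩ := exists_partition_lipschitzOnWith hK hε
    have hpiece : ∀ i, ENNReal.ofReal |T ((E i).indicator 1) u| ≤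
        ∫⁻ y in E i, (pLip u univ y + ε) ∂ν := by
      intro i
      obtain ⟨g, hg, hug⟩ := (LipschitzOnWith.closure hK.continuous.continuousOn
        (hlip i)).extend_real
      have h := hloc (E i) (hE i) u g ⟨K, hK⟩ ⟨_, hg⟩ hug _ hBone
      simp only [one_mul] at h
      calc ENNReal.ofReal |T ((E i).indicator 1) u|
          = ENNReal.ofReal |T ((E i).indicator 1) g| := by rw [h]
        _ ≤ a i * ν (E i) := hind _ (hE i) g _ hg
        _ = ∫⁻ _ in E i, (a i : ℝ≥0∞) ∂ν := (setLIntegral_const _ _).symm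
        _ ≤ ∫⁻ y in E i, (pLip u univ y + ε) ∂ν := setLIntegral_mono' (hE i) (hle i)
    have hT : u t - u s = T ((⋃ i, E i).indicator 1) u := by
      rw [hcov, indicator_univ, ← hbdry u ⟨K, hK⟩]
      rfl
    calc ENNReal.ofReal |u t - u s|
        ≤ ∑' i, ENNReal.ofReal |T ((E i).indicator 1) u| := by
          rw [hT]
          exact ofReal_abs_iUnion_le_tsum ν (fun A => T (A.indicator 1) u) K hadd
            (fun A hA => hind A hA u K hK) hE hd
      _ ≤ ∑' i, ∫⁻ y in E i, (pLip u univ y + ε) ∂ν := ENNReal.tsum_le_tsum hpiece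
      _ = ∫⁻ y, pLip u univ y ∂ν + ε * ν univ := by
          rw [← lintegral_iUnion hE hd, hcov, Measure.restrict_univ,
            lintegral_add_right _ measurable_const, lintegral_const]
  have hpLip : ENNReal.ofReal |u t - u s| ≤ ∫⁻ y, pLip u univ y ∂ν := by
    have hlim : Tendsto (fun n : ℕ => ∫⁻ y, pLip u univ y ∂ν +
        ((((n : NNReal) + 1)⁻¹ : NNReal) : ℝ≥0∞) * ν univ) atTop
        (nhds (∫⁻ y, pLip u univ y ∂ν)) := by
      have h0 : Tendsto (fun n : ℕ => ((((n : NNReal) + 1)⁻¹ : NNReal) : ℝ≥0∞)) atTop (nhds 0) := by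
        have h := tendsto_one_div_add_atTop_nhds_zero_nat (𝕜 := NNReal)
        simp only [one_div] at h
        exact ENNReal.tendsto_coe.2 h
      have h1 := (ENNReal.Tendsto.mul_const h0 (Or.inr (measure_ne_top ν univ))).const_add
        (∫⁻ y, pLip u univ y ∂ν)
      rwa [zero_mul, add_zero] at h1
    exact ge_of_tendsto' hlim fun n => hbound _ (by positivity)
  calc ENNReal.ofReal |u t - u s|
      ≤ ∫⁻ y, pLip u univ y ∂ν := hpLip
    _ ≤ ∫⁻ y, w y * pLip u univ y ∂μ := lintegral_withDensity_le_lintegral_mul μ hwmeas _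
    _ ≤ ∫⁻ y, (ball s (C₀ * dist s t)).indicator (fun y => ENNReal.ofReal C₀ *
          (pLip u univ y * (invTheta μ s y + invTheta μ t y))) y ∂μ := by
        refine lintegral_mono_ae ?_
        filter_upwards [hw0, hwb] with y h0 hb
        by_cases hy : y ∈ ball s (C₀ * dist s t)
        · rw [indicator_of_mem hy, mul_left_comm, mul_comm (w y)]
          gcongr
        · simp [h0 hy]
    _ = ENNReal.ofReal C₀ * ∫⁻ y in ball s (C₀ * dist s t),
          pLip u univ y * (invTheta μ s y + invTheta μ t y) ∂μ := by
        rw [lintegral_indicator measurableSet_ball, lintegral_const_mul' _ _ ENNReal.ofReal_ne_top]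
end
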